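/- Let N ≥ 2 and suppose π_N and π_{N+1} are monic polynomials of degrees N and N+1 respectively such that ⟨π_N, y^j⟩₁ = 0 and ⟨π_{N+1}, y^j⟩₁ = 0 for all j = 0,…,N−1. If a₁, a₂ ∈ ℂ and q is a polynomial with deg q ≤ N−1 such that a₁·π_{N+1} + a₂·π_N = T(q), then q = 0 and a₁ = a₂ = 0. In other words, the restriction of the decomposition map P ↦ R (from P = T(q) + R with deg R ≤ 1) to span{π_{N+1}, π_N} is injective. -/

import Mathlib

open MeasureTheory Polynomial Set

noncomputable section

/-- The weight `w(x) = e^{−Mx/2}·x^{(M−N−1)/2}·(t−x)^{−1/2}` on `(0,∞)`,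
using the principal branch of the complex power. -/
def wC (M N : ℕ) (t : ℂ) (x : ℝ) : ℂ :=
  Complex.exp (-(M : ℂ) * x / 2) * (x : ℂ) ^ (((((M : ℝ) - N - 1) / 2 : ℝ)) : ℂ) *
    (t - x) ^ (-(1 / 2) : ℂ)

/-- The Laguerre weight `w₀(x) = x^{M−N}·e^{−Mx}`. -/
def w0R (M N : ℕ) (x : ℝ) : ℝ := x ^ (M - N) * Real.exp (-(M : ℝ) * x)

/-- The skew product `⟨f,g⟩₁ = ∫₀^∞∫₀^∞ (1/2)·sgn(x−y)·f(x)·g(y)·w(x)·w(y) dy dx`. -/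
def skew1 (M N : ℕ) (t : ℂ) (f g : Polynomial ℂ) : ℂ :=
  ∫ x in Ioi (0 : ℝ), ∫ y in Ioi (0 : ℝ),
    ((Real.sign (x - y) : ℝ) : ℂ) / 2 * f.eval (x : ℂ) * g.eval (y : ℂ) *
      wC M N t x * wC M N t y

/-- The inner product `⟨f,g⟩₂ = ∫₀^∞ f(x)·g(x)·w₀(x) dx`. -/
def inner2C (M N : ℕ) (f g : Polynomial ℂ) : ℂ :=
  ∫ x in Ioi (0 : ℝ), f.eval (x : ℂ) * g.eval (x : ℂ) * (w0R M N x : ℂ)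

/-- `IsLag M N L` says that `L n` is the monic degree-`n` orthogonal polynomial for the
weight `w₀` (the rescaled Laguerre polynomial). -/
def IsLag (M N : ℕ) (L : ℕ → Polynomial ℂ) : Prop :=
  ∀ n, (L n).Monic ∧ (L n).natDegree = n ∧
    ∀ j, j < n → inner2C M N (L n) (Polynomial.X ^ j) = 0

/-- The operator `T(q)(x) = x(t−x)q′(x) +
[(t−2x) − (M/2)x(t−x) + ((M−N−1)/2)(t−x) + x/2]·q(x)`,
i.e. formally `T(q) = (d/dx)(q·x·(t−x)·w)/w`. -/
def Tq (M N : ℕ) (t : ℂ) (q : Polynomial ℂ) : Polynomial ℂ :=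
  Polynomial.X * (Polynomial.C t - Polynomial.X) * Polynomial.derivative q +
    ((Polynomial.C t - 2 * Polynomial.X)
        - Polynomial.C ((M : ℂ) / 2) * (Polynomial.X * (Polynomial.C t - Polynomial.X))
        + Polynomial.C (((M : ℂ) - N - 1) / 2) * (Polynomial.C t - Polynomial.X)
        + Polynomial.C (1 / 2) * Polynomial.X) * q

/-- `ε(f)(x) = ∫₀^∞ (1/2)·sgn(x−y)·f(y) dy`. -/
def epsC (f : ℝ → ℂ) (x : ℝ) : ℂ :=
  ∫ y in Ioi (0 : ℝ), ((Real.sign (x - y) : ℝ) : ℂ) / 2 * f y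

/-- The squared norm `h_{n,0} = ∫₀^∞ L_n(x)²·w₀(x) dx`. -/
def hC (M N : ℕ) (L : ℕ → Polynomial ℂ) (n : ℕ) : ℂ :=
  ∫ x in Ioi (0 : ℝ), (L n).eval (x : ℂ) ^ 2 * (w0R M N x : ℂ)

end

lemma measurable_real_sign : Measurable Real.sign := by
  unfold Real.sign
  exact Measurable.ite measurableSet_Iio measurable_const
    (Measurable.ite measurableSet_Ioi measurable_const measurable_const)

lemma aestronglyMeasurable_sign_div_two (y : ℝ) {μ : Measure ℝ} :
    AEStronglyMeasurable (fun x : ℝ => ((Real.sign (x - y) : ℝ) : ℂ) / 2) μ :=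
  ((Complex.measurable_ofReal.comp (measurable_real_sign.comp
    (measurable_id.sub_const y))).div_const 2).aestronglyMeasurable

lemma norm_sign_div_two_le (r : ℝ) : ‖((Real.sign r : ℝ) : ℂ) / 2‖ ≤ 1 := by
  rcases Real.sign_apply_eq r with h | h | h <;> rw [h] <;> norm_num

/-- A function bounded by `C·x^s·e^{-bx}` on `(0,∞)` is integrable there against polynomials. -/
lemma integrableOn_eval_mul_of_norm_le {f : ℝ → ℂ} {C s b : ℝ} (hs : 0 ≤ s) (hb : 0 < b)
    (hf : AEStronglyMeasurable f (volume.restrict (Ioi 0)))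
    (hbound : ∀ x : ℝ, 0 < x → ‖f x‖ ≤ C * (x ^ s * Real.exp (-b * x))) (p : ℂ[X]) :
    IntegrableOn (fun x : ℝ => p.eval (x : ℂ) * f x) (Ioi 0) := by
  induction p using Polynomial.induction_on' with
  | add p q hp hq =>
    simp only [eval_add, add_mul]
    exact hp.add hq
  | monomial n a =>
    have hintegrable := integrableOn_rpow_mul_exp_neg_mul_rpow (s := s + n) (p := 1) (b := b)
      (by linarith [(Nat.cast_nonneg n : (0 : ℝ) ≤ n)]) one_pos hb
    refine Integrable.mono' (hintegrable.const_mul (‖a‖ * C)) ?_ ?_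
    · refine AEStronglyMeasurable.mul ?_ hf
      exact (((monomial n a).continuous).comp Complex.continuous_ofReal).aestronglyMeasurable
    · refine (ae_restrict_mem measurableSet_Ioi).mono fun x hx => ?_
      have hx : 0 < x := hx
      have h := mul_le_mul_of_nonneg_left (hbound x hx)
        (by positivity : 0 ≤ ‖a‖ * x ^ n)
      simp only [eval_monomial, norm_mul, norm_pow, Complex.norm_real, Real.norm_eq_abs,
        abs_of_pos hx, Real.rpow_one, Real.rpow_add hx, Real.rpow_natCast]
      calc _ ≤ _ := h
        _ = _ := by ring

/-- If `‖f x‖ ≤ C·x^s·e^{-bx}` on `(0,∞)` with `s ≥ 0`, then `p(x)·x·f(x)` vanishes at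
both ends of `(0,∞)` for every polynomial `p`. -/
lemma tendsto_eval_mul_of_norm_le {f : ℝ → ℂ} {C s b : ℝ} (hs : 0 ≤ s) (hb : 0 < b)
    (hbound : ∀ x : ℝ, 0 < x → ‖f x‖ ≤ C * (x ^ s * Real.exp (-b * x))) (p : ℂ[X]) :
    Filter.Tendsto (fun x : ℝ => p.eval (x : ℂ) * x * f x) (nhdsWithin 0 (Ioi 0)) (nhds 0) ∧
      Filter.Tendsto (fun x : ℝ => p.eval (x : ℂ) * x * f x) Filter.atTop (nhds 0) := by
  induction p using Polynomial.induction_on' with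
  | add p q hp hq =>
    simp only [eval_add, add_mul]
    exact ⟨by simpa using hp.1.add hq.1, by simpa using hp.2.add hq.2⟩
  | monomial n a =>
    have hle : ∀ x : ℝ, 0 < x → ‖(monomial n a).eval (x : ℂ) * x * f x‖ ≤
        ‖a‖ * C * (x ^ (s + n + 1) * Real.exp (-b * x)) := by
      intro x hx
      have h := mul_le_mul_of_nonneg_left (hbound x hx)
        (by positivity : 0 ≤ ‖a‖ * x ^ n * x)
      simp only [eval_monomial, norm_mul, norm_pow, Complex.norm_real, Real.norm_eq_abs,
        abs_of_pos hx, Real.rpow_one, Real.rpow_add hx, Real.rpow_natCast]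
      calc _ ≤ _ := h
        _ = _ := by ring
    have hpos : 0 < s + n + 1 := by positivity
    constructor
    · refine squeeze_zero_norm' (Filter.eventually_of_mem self_mem_nhdsWithin hle) ?_
      have hc : ContinuousAt
          (fun x : ℝ => ‖a‖ * C * (x ^ (s + n + 1) * Real.exp (-b * x))) 0 :=
        continuousAt_const.mul ((Real.continuousAt_rpow_const _ _ (Or.inr hpos.le)).mul
          (by fun_prop))
      have h0 := hc.tendsto
      rw [Real.zero_rpow hpos.ne'] at h0
      simpa using h0.mono_left nhdsWithin_le_nhds
    · refine squeeze_zero_norm' ((Filter.eventually_gt_atTop 0).mono hle) ?_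
      simpa using (tendsto_rpow_mul_exp_neg_mul_atTop_nhds_zero (s + n + 1) b hb).const_mul
        (‖a‖ * C)

lemma sub_ofReal_mem_slitPlane {t : ℂ} (ht : t.im ≠ 0) (x : ℝ) :
    t - x ∈ Complex.slitPlane := by
  right
  simpa using ht

lemma exponent_nonneg {M N : ℕ} (hNM : N < M) : 0 ≤ ((M : ℝ) - N - 1) / 2 := by
  have : (N : ℝ) + 1 ≤ M := by exact_mod_cast hNM
  linarith

lemma norm_wC_le {M N : ℕ} {t : ℂ} (ht : t.im ≠ 0) {x : ℝ} (hx : 0 < x) :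
    ‖wC M N t x‖ ≤ |t.im| ^ (-(1 / 2) : ℝ) *
      (x ^ (((M : ℝ) - N - 1) / 2) * Real.exp (-((M : ℝ) / 2) * x)) := by
  have h1 : ‖Complex.exp (-(M : ℂ) * x / 2)‖ = Real.exp (-((M : ℝ) / 2) * x) := by
    rw [show (-(M : ℂ) * x / 2) = ((-((M : ℝ) / 2) * x : ℝ) : ℂ) by push_cast; ring,
      Complex.norm_exp_ofReal]
  have h2 : ‖(t - x) ^ (-(1 / 2) : ℂ)‖ ≤ |t.im| ^ (-(1 / 2) : ℝ) := by
    have hne := Complex.slitPlane_ne_zero (sub_ofReal_mem_slitPlane ht x)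
    rw [show (-(1 / 2) : ℂ) = ((-(1 / 2) : ℝ) : ℂ) by push_cast; ring,
      Complex.norm_cpow_of_ne_zero hne]
    simp only [Complex.ofReal_re, Complex.ofReal_im, mul_zero, Real.exp_zero, div_one]
    refine Real.rpow_le_rpow_of_nonpos (abs_pos.2 ht) ?_ (by norm_num)
    simpa using Complex.abs_im_le_norm (t - x)
  rw [wC, norm_mul, norm_mul, h1, Complex.norm_cpow_eq_rpow_re_of_pos hx, Complex.ofReal_re]
  calc _ ≤ Real.exp (-((M : ℝ) / 2) * x) * x ^ (((M : ℝ) - N - 1) / 2) *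
        |t.im| ^ (-(1 / 2) : ℝ) := by gcongr
    _ = _ := by ring

lemma measurable_wC (M N : ℕ) (t : ℂ) : Measurable (wC M N t) := by
  unfold wC
  fun_prop

lemma integrableOn_eval_mul_wC {M N : ℕ} (hNM : N < M) {t : ℂ} (ht : t.im ≠ 0) (p : ℂ[X]) :
    IntegrableOn (fun x : ℝ => p.eval (x : ℂ) * wC M N t x) (Ioi 0) :=
  integrableOn_eval_mul_of_norm_le (exponent_nonneg hNM)
    (half_pos (by exact_mod_cast (Nat.zero_le N).trans_lt hNM))
    (measurable_wC M N t).aestronglyMeasurable (fun _ hx => norm_wC_le ht hx) p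

lemma integrableOn_eval_mul_w0R {M N : ℕ} (hNM : N < M) (p : ℂ[X]) :
    IntegrableOn (fun x : ℝ => p.eval (x : ℂ) * (w0R M N x : ℂ)) (Ioi 0) := by
  refine integrableOn_eval_mul_of_norm_le (C := 1) (s := ((M - N : ℕ) : ℝ)) (b := M)
    (Nat.cast_nonneg _) (by exact_mod_cast (Nat.zero_le N).trans_lt hNM) ?_ ?_ p
  · unfold w0R
    exact Continuous.aestronglyMeasurable (by fun_prop)
  · intro x hx
    rw [Complex.norm_real, Real.norm_eq_abs, abs_of_nonneg (by unfold w0R; positivity), w0R,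
      Real.rpow_natCast, one_mul]

/-- `x(t−x)·w(x)² = w₀(x)`. -/
lemma mul_wC_sq {M N : ℕ} (hNM : N < M) {t : ℂ} (ht : t.im ≠ 0) {x : ℝ} (hx : 0 < x) :
    (x : ℂ) * (t - x) * wC M N t x ^ 2 = (w0R M N x : ℂ) := by
  have hne := Complex.slitPlane_ne_zero (sub_ofReal_mem_slitPlane ht x)
  have hx0 : (x : ℂ) ≠ 0 := by exact_mod_cast hx.ne'
  have h1 : Complex.exp (-(M : ℂ) * x / 2) ^ 2 = Complex.exp (-(M : ℂ) * x) := by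
    rw [← Complex.exp_nat_mul]
    congr 1
    push_cast
    ring
  have h2 : ((x : ℂ) ^ (((((M : ℝ) - N - 1) / 2 : ℝ)) : ℂ)) ^ 2 * x = (x : ℂ) ^ (M - N) := by
    rw [← Complex.cpow_nat_mul, ← Complex.cpow_natCast (x : ℂ) (M - N)]
    nth_rewrite 2 [← Complex.cpow_one (x : ℂ)]
    rw [← Complex.cpow_add _ _ hx0]
    congr 1
    push_cast [Nat.cast_sub hNM.le]
    ring
  have h3 : ((t - x) ^ (-(1 / 2) : ℂ)) ^ 2 * (t - x) = 1 := by
    rw [← Complex.cpow_nat_mul]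
    nth_rewrite 2 [← Complex.cpow_one (t - x)]
    rw [← Complex.cpow_add _ _ hne]
    norm_num
  rw [wC, w0R]
  simp only [Complex.ofReal_mul, Complex.ofReal_pow, Complex.ofReal_exp, Complex.ofReal_neg,
    Complex.ofReal_natCast]
  rw [← h1, ← h2]
  linear_combination (Complex.exp (-(M : ℂ) * x / 2) ^ 2 *
    ((x : ℂ) ^ (((((M : ℝ) - N - 1) / 2 : ℝ)) : ℂ)) ^ 2 * x) * h3

lemma hasDerivAt_wC (M N : ℕ) {t : ℂ} (ht : t.im ≠ 0) {x : ℝ} (hx : 0 < x) :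
    HasDerivAt (wC M N t)
      ((-(M : ℂ) / 2 + ((M : ℂ) - N - 1) / 2 / x + 1 / 2 / (t - x)) * wC M N t x) x := by
  have hne := Complex.slitPlane_ne_zero (sub_ofReal_mem_slitPlane ht x)
  have hx0 : (x : ℂ) ≠ 0 := by exact_mod_cast hx.ne'
  have hid := hasDerivAt_id (x : ℂ)
  have h1 := ((hid.const_mul (-(M : ℂ))).div_const 2).cexp
  have h2 := hid.cpow_const (c := (((((M : ℝ) - N - 1) / 2 : ℝ)) : ℂ))
    (Complex.ofReal_mem_slitPlane.2 hx)
  have h3 := (hid.const_sub t).cpow_const (c := (-(1 / 2) : ℂ)) (sub_ofReal_mem_slitPlane ht x)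
  have h := ((h1.mul h2).mul h3).comp_ofReal
  refine h.congr_deriv ?_
  simp only [id, wC, Pi.mul_apply, Complex.cpow_sub _ _ hx0, Complex.cpow_sub _ _ hne,
    Complex.cpow_one]
  push_cast
  field_simp

/-- `T(q)·w` is the derivative of `q·x(t−x)·w`. -/
lemma hasDerivAt_eval_mul_wC (M N : ℕ) {t : ℂ} (ht : t.im ≠ 0) (q : ℂ[X]) {x : ℝ}
    (hx : 0 < x) :
    HasDerivAt (fun y : ℝ => (q * (C t - X)).eval (y : ℂ) * y * wC M N t y)
      ((Tq M N t q).eval (x : ℂ) * wC M N t x) x := by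
  have hne := Complex.slitPlane_ne_zero (sub_ofReal_mem_slitPlane ht x)
  have hx0 : (x : ℂ) ≠ 0 := by exact_mod_cast hx.ne'
  have h1 := ((q * (C t - X)).hasDerivAt (x : ℂ)).comp_ofReal
  have h2 := (hasDerivAt_id (x : ℂ)).comp_ofReal
  refine ((h1.mul h2).mul (hasDerivAt_wC M N ht hx)).congr_deriv ?_
  simp only [Tq, id, Pi.mul_apply, derivative_mul, derivative_sub, derivative_C, derivative_X,
    eval_mul, eval_add, eval_sub, eval_C, eval_X, eval_ofNat, eval_zero, eval_one]
  field_simp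
  ring

/-- The kernel `½·sgn(x−y)` inverts differentiation: integrating it against `T(q)·w` returns
`−q(y)·y(t−y)·w(y)`. -/
lemma integral_sign_mul_Tq {M N : ℕ} (hNM : N < M) {t : ℂ} (ht : t.im ≠ 0) (q : ℂ[X]) {y : ℝ}
    (hy : 0 < y) :
    ∫ x in Ioi (0 : ℝ), ((Real.sign (x - y) : ℝ) : ℂ) / 2 *
        ((Tq M N t q).eval (x : ℂ) * wC M N t x) =
      -((q * (C t - X)).eval (y : ℂ) * y * wC M N t y) := by
  set F : ℝ → ℂ := fun y => (q * (C t - X)).eval (y : ℂ) * y * wC M N t y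
  set G : ℝ → ℂ := fun x => (Tq M N t q).eval (x : ℂ) * wC M N t x
  have hd : ∀ x : ℝ, 0 < x → HasDerivAt F (G x) x := fun x hx =>
    hasDerivAt_eval_mul_wC M N ht q hx
  have hGint : IntegrableOn G (Ioi 0) := integrableOn_eval_mul_wC hNM ht _
  have hlim := tendsto_eval_mul_of_norm_le (exponent_nonneg hNM)
    (half_pos (by exact_mod_cast (Nat.zero_le N).trans_lt hNM : (0 : ℝ) < M))
    (fun _ hx => norm_wC_le (N := N) ht hx) (q * (C t - X))
  have hleft : ∫ x in Ioc 0 y, ((Real.sign (x - y) : ℝ) : ℂ) / 2 * G x = -(1 / 2) * F y := by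
    have hI : ∫ x in (0 : ℝ)..y, G x = F y - 0 :=
      intervalIntegral.integral_eq_sub_of_hasDerivAt_of_tendsto hy (fun x hx => hd x hx.1)
        ((intervalIntegrable_iff_integrableOn_Ioc_of_le hy.le).2
          (hGint.mono_set Ioc_subset_Ioi_self))
        hlim.1 ((hd y hy).continuousAt.tendsto.mono_left nhdsWithin_le_nhds)
    rw [intervalIntegral.integral_of_le hy.le, integral_Ioc_eq_integral_Ioo, sub_zero] at hI
    rw [integral_Ioc_eq_integral_Ioo, ← hI, ← integral_const_mul]
    refine setIntegral_congr_fun measurableSet_Ioo fun x hx => ?_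
    simp only [Real.sign_of_neg (sub_neg.2 hx.2)]
    push_cast
    ring
  have hright : ∫ x in Ioi y, ((Real.sign (x - y) : ℝ) : ℂ) / 2 * G x = -(1 / 2) * F y := by
    have hI : ∫ x in Ioi y, G x = 0 - F y :=
      integral_Ioi_of_hasDerivAt_of_tendsto (hd y hy).continuousAt.continuousWithinAt
        (fun x hx => hd x (hy.trans hx)) (hGint.mono_set (Ioi_subset_Ioi hy.le)) hlim.2
    rw [show -(1 / 2) * F y = 1 / 2 * (0 - F y) by ring, ← hI, ← integral_const_mul]
    refine setIntegral_congr_fun measurableSet_Ioi fun x hx => ?_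
    simp only [Real.sign_of_pos (sub_pos.2 hx)]
    push_cast
    ring
  have hintegrable : IntegrableOn (fun x : ℝ => ((Real.sign (x - y) : ℝ) : ℂ) / 2 * G x) (Ioi 0) :=
    hGint.bdd_mul (c := 1) (aestronglyMeasurable_sign_div_two y)
      (Filter.Eventually.of_forall fun x => norm_sign_div_two_le (x - y))
  rw [← Ioc_union_Ioi_eq_Ioi hy.le,
    setIntegral_union (Ioc_disjoint_Ioi le_rfl) measurableSet_Ioi
      (hintegrable.mono_set Ioc_subset_Ioi_self) (hintegrable.mono_set (Ioi_subset_Ioi hy.le)), hleft, hright]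
  ring

/-- The integrand of the skew product. -/
noncomputable def skewIntegrand (M N : ℕ) (t : ℂ) (f g : ℂ[X]) (z : ℝ × ℝ) : ℂ :=
  ((Real.sign (z.1 - z.2) : ℝ) : ℂ) / 2 * f.eval (z.1 : ℂ) * g.eval (z.2 : ℂ) *
    wC M N t z.1 * wC M N t z.2

lemma integrable_skewIntegrand {M N : ℕ} (hNM : N < M) {t : ℂ} (ht : t.im ≠ 0) (f g : ℂ[X]) :
    Integrable (skewIntegrand M N t f g)
      ((volume.restrict (Ioi 0)).prod (volume.restrict (Ioi 0))) := by
  have h := (integrableOn_eval_mul_wC hNM ht f).mul_prod (integrableOn_eval_mul_wC hNM ht g)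
  have hk := h.bdd_mul (c := 1) (f := fun z : ℝ × ℝ => ((Real.sign (z.1 - z.2) : ℝ) : ℂ) / 2)
    (((Complex.measurable_ofReal.comp (measurable_real_sign.comp
      (measurable_fst.sub measurable_snd))).div_const 2).aestronglyMeasurable)
    (Filter.Eventually.of_forall fun z => norm_sign_div_two_le (z.1 - z.2))
  refine hk.congr (Filter.Eventually.of_forall fun z => ?_)
  simp only [skewIntegrand]
  ring

lemma skew1_eq_integral_prod {M N : ℕ} (hNM : N < M) {t : ℂ} (ht : t.im ≠ 0) (f g : ℂ[X]) :
    skew1 M N t f g = ∫ z, skewIntegrand M N t f g z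
      ∂((volume.restrict (Ioi 0)).prod (volume.restrict (Ioi 0))) :=
  (integral_prod _ (integrable_skewIntegrand hNM ht f g)).symm

lemma skew1_add_left {M N : ℕ} (hNM : N < M) {t : ℂ} (ht : t.im ≠ 0) (f₁ f₂ g : ℂ[X]) :
    skew1 M N t (f₁ + f₂) g = skew1 M N t f₁ g + skew1 M N t f₂ g := by
  simp only [skew1_eq_integral_prod hNM ht]
  rw [← integral_add (integrable_skewIntegrand hNM ht _ _) (integrable_skewIntegrand hNM ht _ _)]
  congr 1 with z
  simp only [skewIntegrand, eval_add]
  ring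

lemma skew1_add_right {M N : ℕ} (hNM : N < M) {t : ℂ} (ht : t.im ≠ 0) (f g₁ g₂ : ℂ[X]) :
    skew1 M N t f (g₁ + g₂) = skew1 M N t f g₁ + skew1 M N t f g₂ := by
  simp only [skew1_eq_integral_prod hNM ht]
  rw [← integral_add (integrable_skewIntegrand hNM ht _ _) (integrable_skewIntegrand hNM ht _ _)]
  congr 1 with z
  simp only [skewIntegrand, eval_add]
  ring

lemma skew1_C_mul_left {M N : ℕ} (hNM : N < M) {t : ℂ} (ht : t.im ≠ 0) (a : ℂ) (f g : ℂ[X]) :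
    skew1 M N t (C a * f) g = a * skew1 M N t f g := by
  simp only [skew1_eq_integral_prod hNM ht]
  rw [← integral_const_mul]
  congr 1 with z
  simp only [skewIntegrand, eval_mul, eval_C]
  ring

lemma skew1_C_mul_right {M N : ℕ} (hNM : N < M) {t : ℂ} (ht : t.im ≠ 0) (a : ℂ) (f g : ℂ[X]) :
    skew1 M N t f (C a * g) = a * skew1 M N t f g := by
  simp only [skew1_eq_integral_prod hNM ht]
  rw [← integral_const_mul]
  congr 1 with z
  simp only [skewIntegrand, eval_mul, eval_C]
  ring

/-- Skew-orthogonality to the monomials `y^j`, `j < n`, extends to all polynomials of degree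
less than `n`. -/
lemma skew1_eq_zero_of_degree_lt {M N : ℕ} (hNM : N < M) {t : ℂ} (ht : t.im ≠ 0) {n : ℕ}
    {f : ℂ[X]} (hf : ∀ j, j < n → skew1 M N t f (X ^ j) = 0) {g : ℂ[X]} (hg : g.natDegree < n) :
    skew1 M N t f g = 0 := by
  let φ : ℂ[X] →ₗ[ℂ] ℂ :=
    { toFun := skew1 M N t f
      map_add' := skew1_add_right hNM ht f
      map_smul' := fun a g => by
        simp only [smul_eq_C_mul, skew1_C_mul_right hNM ht, RingHom.id_apply, smul_eq_mul] }
  change φ g = 0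
  rw [g.as_sum_range' n hg, map_sum]
  refine Finset.sum_eq_zero fun j hj => ?_
  rw [← C_mul_X_pow_eq_monomial, ← smul_eq_C_mul, map_smul]
  simp [φ, hf j (Finset.mem_range.1 hj)]

/-- `⟨T(q), g⟩₁ = −⟨q, g⟩₂`. -/
lemma skew1_Tq {M N : ℕ} (hNM : N < M) {t : ℂ} (ht : t.im ≠ 0) (q g : ℂ[X]) :
    skew1 M N t (Tq M N t q) g = -inner2C M N q g := by
  rw [skew1_eq_integral_prod hNM ht, integral_prod_symm _ (integrable_skewIntegrand hNM ht _ _),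
    inner2C, ← integral_neg]
  refine setIntegral_congr_fun measurableSet_Ioi fun y hy => ?_
  have hy : 0 < y := hy
  have h := integral_sign_mul_Tq hNM ht q hy
  calc ∫ x in Ioi (0 : ℝ), skewIntegrand M N t (Tq M N t q) g (x, y)
      = ∫ x in Ioi (0 : ℝ), (g.eval (y : ℂ) * wC M N t y) *
          (((Real.sign (x - y) : ℝ) : ℂ) / 2 * ((Tq M N t q).eval (x : ℂ) * wC M N t x)) := by
        congr 1 with x
        simp only [skewIntegrand]
        ring
    _ = -(q.eval (y : ℂ) * g.eval (y : ℂ) * (w0R M N y : ℂ)) := by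
        rw [integral_const_mul, h, ← mul_wC_sq hNM ht hy]
        simp only [eval_mul, eval_sub, eval_C, eval_X]
        ring

/-- The form `⟨·,·⟩₂` is positive definite when paired with coefficientwise conjugation. -/
lemma eq_zero_of_inner2C_conj_eq_zero {M N : ℕ} (hNM : N < M) {q : ℂ[X]}
    (h : inner2C M N q (q.map (starRingEnd ℂ)) = 0) : q = 0 := by
  have hpt : ∀ x : ℝ, q.eval (x : ℂ) * (q.map (starRingEnd ℂ)).eval (x : ℂ) * (w0R M N x : ℂ) =
      ((Complex.normSq (q.eval (x : ℂ)) * w0R M N x : ℝ) : ℂ) := by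
    intro x
    have hc : (q.map (starRingEnd ℂ)).eval (x : ℂ) = starRingEnd ℂ (q.eval (x : ℂ)) := by
      conv_lhs => rw [← Complex.conj_ofReal x]
      rw [eval_map_apply]
    rw [hc, Complex.mul_conj]
    push_cast
    ring
  have hintegrable : IntegrableOn (fun x : ℝ => Complex.normSq (q.eval (x : ℂ)) * w0R M N x) (Ioi 0) := by
    have := (integrableOn_eval_mul_w0R hNM (q * q.map (starRingEnd ℂ))).re
    refine this.congr (Filter.Eventually.of_forall fun x => ?_)
    simp only [eval_mul, hpt x]
    exact Complex.ofReal_re _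
  have hzero : ∫ x in Ioi (0 : ℝ), Complex.normSq (q.eval (x : ℂ)) * w0R M N x = 0 := by
    simp only [inner2C, hpt] at h
    exact Complex.ofReal_eq_zero.1 (integral_complex_ofReal.symm.trans h)
  have hae : ∀ᵐ x : ℝ ∂(volume.restrict (Ioi (0 : ℝ))), q.eval (x : ℂ) = 0 := by
    have hnn : 0 ≤ᵐ[volume.restrict (Ioi (0 : ℝ))]
        fun x : ℝ => Complex.normSq (q.eval (x : ℂ)) * w0R M N x := by
      refine (ae_restrict_mem measurableSet_Ioi).mono fun x hx => ?_
      have hx : 0 < x := hx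
      exact mul_nonneg (Complex.normSq_nonneg _) (by unfold w0R; positivity)
    filter_upwards [(integral_eq_zero_iff_of_nonneg_ae hnn hintegrable).1 hzero,
      ae_restrict_mem measurableSet_Ioi] with x hx0 hx
    have hx : 0 < x := hx
    have hw : w0R M N x ≠ 0 := by unfold w0R; positivity
    exact Complex.normSq_eq_zero.1 ((mul_eq_zero.1 hx0).resolve_right hw)
  by_contra hq
  have hfin : {x : ℝ | q.eval (x : ℂ) = 0}.Finite :=
    (q.finite_setOfPred_isRoot hq).preimage Complex.ofReal_injective.injOn
  have hne : ∀ᵐ x : ℝ ∂(volume.restrict (Ioi (0 : ℝ))), q.eval (x : ℂ) ≠ 0 :=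
    ae_restrict_of_ae (by simpa [ae_iff] using hfin.measure_zero volume)
  have hbot : (ae (volume.restrict (Ioi (0 : ℝ)))).NeBot := by
    rw [ae_neBot, Ne, Measure.restrict_eq_zero]
    simp
  obtain ⟨x, hx, hx'⟩ := (hae.and hne).exists
  exact hx' hx

/-- Let `π_N, π_{N+1}` be monic of degrees `N, N+1` with
`⟨π_N, y^j⟩₁ = ⟨π_{N+1}, y^j⟩₁ = 0` for `j = 0,…,N−1`.  If
`a₁·π_{N+1} + a₂·π_N = T(q)` with `deg q ≤ N−1`, then `q = 0` and `a₁ = a₂ = 0`. -/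
theorem stmt_9 (M N : ℕ) (hN : 2 ≤ N) (hNM : N < M) (t : ℂ) (ht : t.im ≠ 0)
    (πN πN1 : Polynomial ℂ)
    (hπN : πN.Monic ∧ πN.natDegree = N ∧
      ∀ j, j < N → skew1 M N t πN (Polynomial.X ^ j) = 0)
    (hπN1 : πN1.Monic ∧ πN1.natDegree = N + 1 ∧
      ∀ j, j < N → skew1 M N t πN1 (Polynomial.X ^ j) = 0)
    (a₁ a₂ : ℂ) (q : Polynomial ℂ) (hq : q.natDegree ≤ N - 1)
    (heq : Polynomial.C a₁ * πN1 + Polynomial.C a₂ * πN = Tq M N t q) :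
    q = 0 ∧ a₁ = 0 ∧ a₂ = 0 := by
  obtain ⟨hmon, hdeg, horth⟩ := hπN
  obtain ⟨hmon1, hdeg1, horth1⟩ := hπN1
  have hq0 : q = 0 := by
    refine eq_zero_of_inner2C_conj_eq_zero hNM ?_
    have hconj : (q.map (starRingEnd ℂ)).natDegree < N :=
      natDegree_map_le.trans_lt (by omega)
    rw [← neg_eq_zero, ← skew1_Tq hNM ht, ← heq, skew1_add_left hNM ht, skew1_C_mul_left hNM ht,
      skew1_C_mul_left hNM ht, skew1_eq_zero_of_degree_lt hNM ht horth1 hconj,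
      skew1_eq_zero_of_degree_lt hNM ht horth hconj]
    simp
  have hsum : C a₁ * πN1 + C a₂ * πN = 0 := by
    rw [heq, hq0]
    simp [Tq]
  have ha₁ : a₁ = 0 := by
    have h := congrArg (fun p => p.coeff (N + 1)) hsum
    simpa [coeff_eq_zero_of_natDegree_lt (show πN.natDegree < N + 1 by omega),
      show πN1.coeff (N + 1) = 1 from hdeg1 ▸ hmon1.coeff_natDegree] using h
  have ha₂ : a₂ = 0 := by
    have h := congrArg (fun p => p.coeff N) hsum
    simpa [ha₁, show πN.coeff N = 1 from hdeg ▸ hmon.coeff_natDegree] using h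
  exact ⟨hq0, ha₁, ha₂⟩
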